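/- For every α : A → S → ℝ, the residual satisfies the lower bound ‖G(α)‖_∞ ≥ (1 − γ) · ‖α − α⋆‖_∞. -/

import Mathlib

open Finset Filter

/-- The fast informed bound (FIB) operator:
`(F α) a s = r s a + γ · Σ_o max_{a'} Σ_{s'} Ω s' a o · T s a s' · α a' s'`. -/
noncomputable def FIB {S A O : Type*} [Fintype S] [Fintype A] [Fintype O] [Nonempty A]
    (T : S → A → S → ℝ) (Ω : S → A → O → ℝ) (r : S → A → ℝ) (γ : ℝ)
    (α : A → S → ℝ) : A → S → ℝ :=
  fun a s => r s a + γ * ∑ o : O,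
    Finset.univ.sup' Finset.univ_nonempty
      (fun a' : A => ∑ s' : S, Ω s' a o * T s a s' * α a' s')

/-- The sup norm `‖α‖_∞ = max_{(a,s)} |α a s|` on `A → S → ℝ`. -/
noncomputable def supNorm {S A : Type*} [Fintype S] [Fintype A] [Nonempty S] [Nonempty A]
    (α : A → S → ℝ) : ℝ :=
  Finset.univ.sup' Finset.univ_nonempty (fun p : A × S => |α p.1 p.2|)

variable {S A O : Type*} [Fintype S] [Fintype A] [Fintype O]
  [Nonempty S] [Nonempty A] [Nonempty O]

theorem FIB_le_aux {S A O : Type*} [Fintype S] [Fintype A] [Fintype O] [Nonempty A]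
    (T : S → A → S → ℝ) (Ω : S → A → O → ℝ) (r : S → A → ℝ) (γ : ℝ)
    (hγ : 0 < γ)
    (hT0 : ∀ s a s', 0 ≤ T s a s') (hT1 : ∀ s a, ∑ s' : S, T s a s' = 1)
    (hΩ0 : ∀ s' a o, 0 ≤ Ω s' a o) (hΩ1 : ∀ s' a, ∑ o : O, Ω s' a o = 1)
    (α β : A → S → ℝ) (M : ℝ) (h : ∀ a s, α a s ≤ β a s + M) (a : A) (s : S) :
    FIB T Ω r γ α a s ≤ FIB T Ω r γ β a s + γ * M := by
  have hw : ∑ o : O, ∑ s' : S, Ω s' a o * T s a s' * M = M := by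
    rw [Finset.sum_comm]
    simp_rw [← Finset.sum_mul, hΩ1, one_mul]
    rw [hT1, one_mul]
  have key : ∑ o : O, Finset.univ.sup' Finset.univ_nonempty
        (fun a' : A => ∑ s' : S, Ω s' a o * T s a s' * α a' s')
      ≤ ∑ o : O, (Finset.univ.sup' Finset.univ_nonempty
        (fun a' : A => ∑ s' : S, Ω s' a o * T s a s' * β a' s')
        + ∑ s' : S, Ω s' a o * T s a s' * M) := by
    refine Finset.sum_le_sum fun o _ => ?_
    refine Finset.sup'_le _ _ fun a' _ => ?_
    have h1 : ∑ s' : S, Ω s' a o * T s a s' * α a' s' ≤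
        ∑ s' : S, Ω s' a o * T s a s' * β a' s' + ∑ s' : S, Ω s' a o * T s a s' * M := by
      rw [← Finset.sum_add_distrib]
      refine Finset.sum_le_sum fun s' _ => ?_
      rw [← mul_add]
      exact mul_le_mul_of_nonneg_left (h a' s') (mul_nonneg (hΩ0 _ _ _) (hT0 _ _ _))
    have h2 := Finset.le_sup' (fun a' : A => ∑ s' : S, Ω s' a o * T s a s' * β a' s')
      (Finset.mem_univ a')
    linarith
  rw [Finset.sum_add_distrib, hw] at key
  have := mul_le_mul_of_nonneg_left key hγ.le
  unfold FIB
  linarith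

theorem abs_le_supNorm_aux {S A : Type*} [Fintype S] [Fintype A] [Nonempty S] [Nonempty A]
    (α : A → S → ℝ) (a : A) (s : S) : |α a s| ≤ supNorm α :=
  Finset.le_sup' (fun p : A × S => |α p.1 p.2|) (Finset.mem_univ (a, s))

theorem fib_residual_lower_bound
    (T : S → A → S → ℝ) (Ω : S → A → O → ℝ) (r : S → A → ℝ) (γ : ℝ)
    (hγ : 0 < γ) (hγ1 : γ < 1)
    (hT0 : ∀ s a s', 0 ≤ T s a s') (hT1 : ∀ s a, ∑ s' : S, T s a s' = 1)
    (hΩ0 : ∀ s' a o, 0 ≤ Ω s' a o) (hΩ1 : ∀ s' a, ∑ o : O, Ω s' a o = 1)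
    (αstar : A → S → ℝ) (hstar : FIB T Ω r γ αstar = αstar)
    :
    ∀ α : A → S → ℝ,
      (1 - γ) * supNorm (α - αstar) ≤ supNorm (α - FIB T Ω r γ α) := by
  intro α
  have hM := abs_le_supNorm_aux (α - αstar)
  have hR := abs_le_supNorm_aux (α - FIB T Ω r γ α)
  have hle : supNorm (α - αstar) ≤
      supNorm (α - FIB T Ω r γ α) + γ * supNorm (α - αstar) := by
    conv_lhs => unfold supNorm
    refine Finset.sup'_le _ _ fun p _ => ?_
    obtain ⟨a, s⟩ := p
    have h1 := FIB_le_aux T Ω r γ hγ hT0 hT1 hΩ0 hΩ1 α αstar (supNorm (α - αstar))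
      (fun a s => by have := (abs_le.1 (hM a s)).2; simp only [Pi.sub_apply] at this; linarith) a s
    have h2 := FIB_le_aux T Ω r γ hγ hT0 hT1 hΩ0 hΩ1 αstar α (supNorm (α - αstar))
      (fun a s => by have := (abs_le.1 (hM a s)).1; simp only [Pi.sub_apply] at this; linarith) a s
    rw [hstar] at h1 h2
    have h3 := abs_le.1 (hR a s)
    simp only [Pi.sub_apply] at h3 ⊢
    rw [abs_le]
    constructor <;> linarith [h3.1, h3.2]
  linarith
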